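/- Let l_1, …, l_n be positive constants such that V_n is C¹ on ℝ^n ∖ {0}. Then for every C > 0 there exists K > 0 such that for every x ∈ ℝ^n with V_n(x) ≥ C and every u ∈ ℝ with |u| ≤ 1, one has |∇V_n(x)·(J_n x + e_n u)| ≤ K V_n(x)^α, where α = 2(n−1)/(2n−1). -/

import Mathlib

open MeasureTheory Filter Matrix

noncomputable section

/-- The signed power `⌊x⌉^a = |x|^a · sign x`. -/
def sgnPow (x a : ℝ) : ℝ := |x| ^ a * Real.sign x

/-- The exponents `p_i = 1 - (i-1)/n`. -/
def pe (n i : ℕ) : ℝ := 1 - ((i : ℝ) - 1) / n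

/-- The exponents `β_0 = p_2`, `β_i = (n-1+i)/(n-i)`. -/
def be (n i : ℕ) : ℝ := if i = 0 then pe n 2 else ((n : ℝ) - 1 + i) / ((n : ℝ) - i)

/-- The exponent `α = 2(n-1)/(2n-1)`. -/
def al (n : ℕ) : ℝ := 2 * ((n : ℝ) - 1) / (2 * (n : ℝ) - 1)

/-- The recursively defined virtual controls `v_i`; states are 1-indexed sequences
(the 0-th coordinate is unused). -/
def vfb (n : ℕ) (l : ℕ → ℝ) : ℕ → (ℕ → ℝ) → ℝ
  | 0, _ => 0
  | i + 1, x =>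
    -l (i + 1) *
      sgnPow (sgnPow (x (i + 1)) (be n i) - sgnPow (vfb n l i x) (be n i))
        (pe n (i + 2) / (pe n (i + 1) * be n i))

/-- `ω_i(x_1,…,x_i) = ⌊x_i⌉^{β_{i-1}} - ⌊v_{i-1}⌉^{β_{i-1}}`. -/
def omfb (n : ℕ) (l : ℕ → ℝ) (i : ℕ) (x : ℕ → ℝ) : ℝ :=
  sgnPow (x i) (be n (i - 1)) - sgnPow (vfb n l (i - 1) x) (be n (i - 1))

/-- `W_i`. -/
def Wfb (n : ℕ) (l : ℕ → ℝ) (i : ℕ) (x : ℕ → ℝ) : ℝ :=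
  (|x i| ^ (be n (i - 1) + 1) - |vfb n l (i - 1) x| ^ (be n (i - 1) + 1)) / (be n (i - 1) + 1) -
    sgnPow (vfb n l (i - 1) x) (be n (i - 1)) * (x i - vfb n l (i - 1) x)

/-- Embedding of `ℝ^n` into 1-indexed sequences. -/
def emb (n : ℕ) (x : Fin n → ℝ) (j : ℕ) : ℝ :=
  if h : 1 ≤ j ∧ j ≤ n then x ⟨j - 1, by omega⟩ else 0

/-- The Lyapunov function `V_n = Σ_{i=1}^n W_i` on `ℝ^n`. -/
def Vn (n : ℕ) (l : ℕ → ℝ) (x : Fin n → ℝ) : ℝ :=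
  ∑ i ∈ Finset.Icc 1 n, Wfb n l i (emb n x)

/-- `ω_n` on `ℝ^n`. -/
def omn (n : ℕ) (l : ℕ → ℝ) (x : Fin n → ℝ) : ℝ := omfb n l n (emb n x)

/-- The `n`-th Jordan block: `(J_n)_{ij} = 1` if `i = j - 1` (1-indexed), else `0`. -/
def Jmat (n : ℕ) : Matrix (Fin n) (Fin n) ℝ :=
  Matrix.of fun i j => if (i : ℕ) + 1 = (j : ℕ) then 1 else 0

/-- The `i`-th standard basis vector of `ℝ^n` (1-indexed: `eVec n n = e_n`). -/
def eVec (n i : ℕ) : Fin n → ℝ := fun j => if (j : ℕ) + 1 = i then 1 else 0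

lemma pe_pos {n i : ℕ} (hn : 0 < n) (hi : i ≤ n) : 0 < pe n i := by
  have hn' : (0 : ℝ) < n := by exact_mod_cast hn
  have hi' : (i : ℝ) ≤ n := by exact_mod_cast hi
  rw [pe, sub_pos, div_lt_one hn']
  linarith

lemma be_pos {n i : ℕ} (hn : 2 ≤ n) (hi : i < n) : 0 < be n i := by
  rw [be]
  split_ifs with h
  · exact pe_pos (by omega) hn
  · have hn' : (2 : ℝ) ≤ n := by exact_mod_cast hn
    have hi' : (i : ℝ) < n := by exact_mod_cast hi
    have hi0 : (0 : ℝ) ≤ i := by positivity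
    apply div_pos <;> linarith

/-- Every `W_i` has the same weighted degree `(2n-1)/n`. -/
lemma pe_mul_be_add_one {n i : ℕ} (hi : i < n) :
    pe n (i + 1) * (be n i + 1) = (2 * n - 1) / n := by
  have hi' : (i : ℝ) < n := by exact_mod_cast hi
  have hn' : (n : ℝ) ≠ 0 := by
    have : (0 : ℝ) ≤ i := by positivity
    linarith
  have hni : (n : ℝ) - i ≠ 0 := by linarith
  rw [be]
  split_ifs with h
  · subst h
    simp only [pe]
    push_cast
    field_simp
    ring
  · simp only [pe]
    push_cast
    field_simp
    ring

lemma sgnPow_zero_left (b : ℝ) : sgnPow 0 b = 0 := by simp [sgnPow]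

lemma abs_rpow_mul {t : ℝ} (ht : 0 < t) (a b x : ℝ) :
    |t ^ a * x| ^ b = t ^ (a * b) * |x| ^ b := by
  have h : 0 < t ^ a := Real.rpow_pos_of_pos ht a
  rw [abs_mul, abs_of_pos h, Real.mul_rpow h.le (abs_nonneg x), ← Real.rpow_mul ht.le]

lemma sgnPow_rpow_mul {t : ℝ} (ht : 0 < t) (a b x : ℝ) :
    sgnPow (t ^ a * x) b = t ^ (a * b) * sgnPow x b := by
  have h : 0 < t ^ a := Real.rpow_pos_of_pos ht a
  have hs : Real.sign (t ^ a * x) = Real.sign x := by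
    rcases lt_trichotomy x 0 with hx | hx | hx
    · rw [Real.sign_of_neg hx, Real.sign_of_neg (mul_neg_of_pos_of_neg h hx)]
    · simp [hx]
    · rw [Real.sign_of_pos hx, Real.sign_of_pos (mul_pos h hx)]
  rw [sgnPow, sgnPow, abs_rpow_mul ht, hs, mul_assoc]

/-- The weighted dilation `x_i ↦ t^{p_i} x_i`. -/
def dil (n : ℕ) (t : ℝ) : (Fin n → ℝ) →L[ℝ] (Fin n → ℝ) :=
  ContinuousLinearMap.pi fun i =>
    (t ^ pe n ((i : ℕ) + 1)) • ContinuousLinearMap.proj (R := ℝ) (φ := fun _ : Fin n => ℝ) i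

lemma dil_apply (n : ℕ) (t : ℝ) (x : Fin n → ℝ) (i : Fin n) :
    dil n t x i = t ^ pe n ((i : ℕ) + 1) * x i := rfl

lemma emb_dil (n : ℕ) (t : ℝ) (x : Fin n → ℝ) (j : ℕ) :
    emb n (dil n t x) j = t ^ pe n j * emb n x j := by
  unfold emb
  split_ifs with h
  · rw [dil_apply]
    congr 3
    show j - 1 + 1 = j
    omega
  · simp

lemma vfb_homogeneous {n : ℕ} (l : ℕ → ℝ) {t : ℝ} (ht : 0 < t) {x y : ℕ → ℝ}
    (hy : ∀ j, y j = t ^ pe n j * x j) :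
    ∀ i, i < n → vfb n l i y = t ^ pe n (i + 1) * vfb n l i x
  | 0, _ => by simp [vfb]
  | i + 1, hi => by
    have hp : pe n (i + 1) * be n i ≠ 0 :=
      (mul_pos (pe_pos (by omega) (by omega)) (be_pos (by omega) (by omega))).ne'
    rw [vfb, vfb, vfb_homogeneous l ht hy i (by omega), hy, sgnPow_rpow_mul ht,
      sgnPow_rpow_mul ht, ← mul_sub, sgnPow_rpow_mul ht, mul_div_cancel₀ _ hp]
    ring

lemma Wfb_homogeneous {n : ℕ} (l : ℕ → ℝ) {t : ℝ} (ht : 0 < t) {x y : ℕ → ℝ}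
    (hy : ∀ j, y j = t ^ pe n j * x j) {i : ℕ} (hi : i < n) :
    Wfb n l (i + 1) y = t ^ ((2 * n - 1) / n : ℝ) * Wfb n l (i + 1) x := by
  have hd := pe_mul_be_add_one hi
  simp only [Wfb, Nat.add_sub_cancel]
  rw [vfb_homogeneous l ht hy i hi, hy, abs_rpow_mul ht, abs_rpow_mul ht, sgnPow_rpow_mul ht,
    ← hd, mul_add, mul_one, Real.rpow_add ht]
  ring

lemma Vn_dil (n : ℕ) (l : ℕ → ℝ) {t : ℝ} (ht : 0 < t) (x : Fin n → ℝ) :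
    Vn n l (dil n t x) = t ^ ((2 * n - 1) / n : ℝ) * Vn n l x := by
  rw [Vn, Vn, Finset.mul_sum]
  refine Finset.sum_congr rfl fun i hi => ?_
  rw [Finset.mem_Icc] at hi
  obtain ⟨k, rfl⟩ : ∃ k, i = k + 1 := ⟨i - 1, by omega⟩
  exact Wfb_homogeneous l ht (emb_dil n t x) (by omega)

/-- Strict convexity of `|x|^(b+1)/(b+1)`, as positivity of its Bregman divergence. -/
lemma bregman_pos {b x v : ℝ} (hb : 0 < b) (h : x ≠ v) :
    0 < (|x| ^ (b + 1) - |v| ^ (b + 1)) / (b + 1) - sgnPow v b * (x - v) := by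
  have hb1 : 0 < b + 1 := by linarith
  rcases eq_or_ne v 0 with rfl | hv
  · have : 0 < |x| ^ (b + 1) := Real.rpow_pos_of_pos (abs_pos.2 h) _
    simp only [sgnPow_zero_left, abs_zero, Real.zero_rpow hb1.ne', sub_zero, zero_mul]
    positivity
  have hv' : 0 < |v| := abs_pos.2 hv
  have hvb : 0 < |v| ^ b := Real.rpow_pos_of_pos hv' b
  have hsv : Real.sign v * v = |v| := by
    rcases hv.lt_or_gt with h | h
    · rw [Real.sign_of_neg h, abs_of_neg h]; ring
    · rw [Real.sign_of_pos h, abs_of_pos h]; ring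
  have hsx : Real.sign v * x ≤ |x| := by
    rcases hv.lt_or_gt with h | h
    · rw [Real.sign_of_neg h]; linarith [neg_abs_le x]
    · rw [Real.sign_of_pos h]; linarith [le_abs_self x]
  have hvp : |v| ^ (b + 1) = |v| ^ b * |v| := by
    rw [Real.rpow_add hv', Real.rpow_one]
  have hxp : |x| ^ (b + 1) = |v| ^ b * |v| * (1 + (|x| / |v| - 1)) ^ (b + 1) := by
    rw [← hvp, ← Real.mul_rpow hv'.le (by rw [add_sub_cancel]; positivity), add_sub_cancel,
      mul_div_cancel₀ _ hv'.ne']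
  have hs : -1 ≤ |x| / |v| - 1 := by
    have : 0 ≤ |x| / |v| := by positivity
    linarith
  have hlin : |v| * (1 + (b + 1) * (|x| / |v| - 1)) = |v| + (b + 1) * (|x| - |v|) := by
    field_simp
  rw [sgnPow, sub_pos, lt_div_iff₀ hb1, hxp, hvp]
  have key : |v| ^ b * Real.sign v * (x - v) * (b + 1)
      = |v| ^ b * ((b + 1) * (Real.sign v * x - |v|)) := by
    rw [← hsv]; ring
  have key2 : |v| ^ b * |v| * (1 + (|x| / |v| - 1)) ^ (b + 1) - |v| ^ b * |v|
      = |v| ^ b * (|v| * (1 + (|x| / |v| - 1)) ^ (b + 1) - |v|) := by ring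
  rw [key, key2]
  refine mul_lt_mul_of_pos_left ?_ hvb
  rcases eq_or_ne (|x|) (|v|) with he | hne
  · have hlt : Real.sign v * x < |v| := by
      rcases abs_eq_abs.1 he with h' | h'
      · exact absurd h' h
      · rw [h', mul_neg, hsv]; linarith
    rw [he, div_self hv'.ne']
    simp only [sub_self, add_zero, Real.one_rpow, mul_one]
    exact mul_neg_of_pos_of_neg hb1 (by linarith)
  · have hs0 : |x| / |v| - 1 ≠ 0 := by
      rw [sub_ne_zero, Ne, div_eq_one_iff_eq hv'.ne']
      exact hne
    have hB := one_add_mul_self_lt_rpow_one_add hs hs0 (by linarith : 1 < b + 1)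
    have h1 := mul_lt_mul_of_pos_left hB hv'
    rw [hlin] at h1
    have h2 : (b + 1) * (Real.sign v * x) ≤ (b + 1) * |x| := mul_le_mul_of_nonneg_left hsx hb1.le
    linarith

lemma Wfb_self {n : ℕ} (l : ℕ → ℝ) {i : ℕ} {x : ℕ → ℝ} (h : x (i + 1) = vfb n l i x) :
    Wfb n l (i + 1) x = 0 := by
  simp [Wfb, h]

lemma Wfb_pos {n : ℕ} (l : ℕ → ℝ) {i : ℕ} (hi : i < n) {x : ℕ → ℝ}
    (h : x (i + 1) ≠ vfb n l i x) : 0 < Wfb n l (i + 1) x := by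
  simp only [Wfb, Nat.add_sub_cancel]
  rcases Nat.lt_or_ge n 2 with hn | hn
  · obtain rfl : n = 1 := by omega
    obtain rfl : i = 0 := by omega
    have hb : be 1 0 = 0 := by norm_num [be, pe]
    simpa [vfb, hb, sgnPow_zero_left] using h
  · exact bregman_pos (be_pos hn hi) h

lemma Vn_pos (n : ℕ) (l : ℕ → ℝ) {x : Fin n → ℝ} (hx : x ≠ 0) : 0 < Vn n l x := by
  have hnn : ∀ i ∈ Finset.Icc 1 n, 0 ≤ Wfb n l i (emb n x) := by
    intro i hi
    rw [Finset.mem_Icc] at hi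
    obtain ⟨k, rfl⟩ : ∃ k, i = k + 1 := ⟨i - 1, by omega⟩
    by_cases h : emb n x (k + 1) = vfb n l k (emb n x)
    · exact (Wfb_self l h).ge
    · exact (Wfb_pos l (by omega) h).le
  refine (Finset.sum_nonneg hnn).lt_of_ne' fun h0 => hx ?_
  rw [Finset.sum_eq_zero_iff_of_nonneg hnn] at h0
  have heq : ∀ k < n, emb n x (k + 1) = vfb n l k (emb n x) := by
    intro k hk
    by_contra h
    exact (Wfb_pos l hk h).ne' (h0 (k + 1) (Finset.mem_Icc.2 ⟨by omega, by omega⟩))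
  have hv : ∀ k, k ≤ n → vfb n l k (emb n x) = 0 := by
    intro k
    induction k with
    | zero => intro _; rfl
    | succ k _ =>
      intro hk
      rw [vfb, heq k (by omega), sub_self, sgnPow_zero_left, mul_zero]
  funext i
  have h := heq i i.2
  rw [hv i i.2.le] at h
  have hi : (i : ℕ) + 1 ≤ n := i.2
  simpa [emb, hi] using h

lemma exists_eq_dil {n : ℕ} {x : Fin n → ℝ} (hx : x ≠ 0) :
    ∃ t : ℝ, 0 < t ∧ ∃ y : Fin n → ℝ, ‖y‖ = 1 ∧ x = dil n t y := by
  obtain ⟨j, hj⟩ : ∃ j, x j ≠ 0 := Function.ne_iff.1 hx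
  have hp : ∀ i : Fin n, 0 < pe n ((i : ℕ) + 1) := fun i => pe_pos (by have := i.2; omega) i.2
  obtain ⟨k, -, hk⟩ := Finset.exists_max_image Finset.univ
    (fun i : Fin n => |x i| ^ (pe n ((i : ℕ) + 1))⁻¹) ⟨j, Finset.mem_univ j⟩
  set t := |x k| ^ (pe n ((k : ℕ) + 1))⁻¹ with ht_def
  have ht : 0 < t := (Real.rpow_pos_of_pos (abs_pos.2 hj) _).trans_le (hk j (Finset.mem_univ j))
  have hle : ∀ i, |x i| ≤ t ^ pe n ((i : ℕ) + 1) := fun i =>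
    (Real.rpow_inv_le_iff_of_pos (abs_nonneg _) ht.le (hp i)).1 (hk i (Finset.mem_univ i))
  have hkt : t ^ pe n ((k : ℕ) + 1) = |x k| := Real.rpow_inv_rpow (abs_nonneg _) (hp k).ne'
  have hpos : ∀ i : Fin n, 0 < t ^ pe n ((i : ℕ) + 1) := fun i => Real.rpow_pos_of_pos ht _
  refine ⟨t, ht, fun i => x i / t ^ pe n ((i : ℕ) + 1), le_antisymm ?_ ?_, ?_⟩
  · refine (pi_norm_le_iff_of_nonneg zero_le_one).2 fun i => ?_
    rw [Real.norm_eq_abs, abs_div, abs_of_pos (hpos i), div_le_one (hpos i)]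
    exact hle i
  · refine le_trans ?_ (norm_le_pi_norm _ k)
    rw [Real.norm_eq_abs, abs_div, abs_of_pos (hpos k), le_div_iff₀ (hpos k), one_mul, hkt]
  · funext i
    rw [dil_apply, mul_div_cancel₀ _ (hpos i).ne']

lemma pe_succ (n i : ℕ) : pe n (i + 1) = pe n i - (n : ℝ)⁻¹ := by
  simp only [pe]
  push_cast
  ring

/-- The controlled chain of integrators is homogeneous of degree `-1/n`. -/
lemma Jmat_mulVec_dil {n : ℕ} (hn : 0 < n) {t : ℝ} (ht : 0 < t) (y : Fin n → ℝ) (u : ℝ) :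
    Jmat n *ᵥ dil n t y + u • eVec n n
      = t ^ (-(n : ℝ)⁻¹) • dil n t (Jmat n *ᵥ y + u • eVec n n) := by
  have hn' : (n : ℝ) ≠ 0 := by exact_mod_cast hn.ne'
  funext i
  simp only [Pi.add_apply, Pi.smul_apply, smul_eq_mul, dil_apply, Matrix.mulVec, dotProduct, Jmat,
    Matrix.of_apply, eVec]
  rw [← mul_assoc, ← Real.rpow_add ht, mul_add, Finset.mul_sum]
  congr 1
  · refine Finset.sum_congr rfl fun j _ => ?_
    split_ifs with h
    · rw [← h, pe_succ n ((i : ℕ) + 1)]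
      ring_nf
    · simp
  · split_ifs with h
    · have : -(n : ℝ)⁻¹ + pe n ((i : ℕ) + 1) = 0 := by
        rw [h, pe]
        field_simp
        ring
      rw [this, Real.rpow_zero, one_mul]
    · simp

lemma fderiv_Vn_dil {n : ℕ} {l : ℕ → ℝ} {t : ℝ} (ht : 0 < t) {y : Fin n → ℝ}
    (hd : DifferentiableAt ℝ (Vn n l) (dil n t y)) (hy : DifferentiableAt ℝ (Vn n l) y)
    (w : Fin n → ℝ) :
    fderiv ℝ (Vn n l) (dil n t y) (dil n t w)
      = t ^ ((2 * n - 1) / n : ℝ) * fderiv ℝ (Vn n l) y w := by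
  have h1 : HasFDerivAt (fun z => Vn n l (dil n t z))
      ((fderiv ℝ (Vn n l) (dil n t y)).comp (dil n t)) y :=
    hd.hasFDerivAt.comp y (dil n t).hasFDerivAt
  have h2 : HasFDerivAt (fun z => Vn n l (dil n t z))
      ((t ^ ((2 * n - 1) / n : ℝ)) • fderiv ℝ (Vn n l) y) y := by
    simp only [Vn_dil n l ht]
    exact hy.hasFDerivAt.const_mul _
  exact congrArg (fun L : (Fin n → ℝ) →L[ℝ] ℝ => L w) (h1.unique h2)

/-- if `V_n` is `C¹` away from the origin, then for every `C > 0` there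
is `K > 0` such that for every `x` with `V_n(x) ≥ C` and every `|u| ≤ 1`,
`|∇V_n(x)·(J_n x + e_n u)| ≤ K V_n(x)^α`. -/
theorem derivative_growth_bound (n : ℕ) (hn : 0 < n)
    (l : ℕ → ℝ) (hl : ∀ i, 0 < l i)
    (hV : ContDiffOn ℝ 1 (Vn n l) {(0 : Fin n → ℝ)}ᶜ) :
    ∀ C : ℝ, 0 < C → ∃ K : ℝ, 0 < K ∧
      ∀ x : Fin n → ℝ, C ≤ Vn n l x → ∀ u : ℝ, |u| ≤ 1 →
        |fderiv ℝ (Vn n l) x ((Jmat n) *ᵥ x + u • eVec n n)| ≤ K * Vn n l x ^ al n := by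
  intro C hC
  have hn' : (1 : ℝ) ≤ n := by exact_mod_cast hn
  have hopen : IsOpen ({(0 : Fin n → ℝ)}ᶜ) := isOpen_compl_singleton
  have hdiff : ∀ x : Fin n → ℝ, x ≠ 0 → DifferentiableAt ℝ (Vn n l) x := fun x hx =>
    (hV.differentiableOn one_ne_zero).differentiableAt (hopen.mem_nhds hx)
  have hsph : ∀ y ∈ Metric.sphere (0 : Fin n → ℝ) 1, y ≠ 0 := fun y hy =>
    ne_zero_of_mem_unit_sphere ⟨y, hy⟩
  let S : Set ((Fin n → ℝ) × ℝ) := Metric.sphere 0 1 ×ˢ Set.Icc (-1) 1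
  have hfst : Set.MapsTo Prod.fst S ({(0 : Fin n → ℝ)}ᶜ) := fun p hp => hsph _ hp.1
  have hcV : ContinuousOn (fun p : (Fin n → ℝ) × ℝ => Vn n l p.1 ^ (-al n)) S :=
    (hV.continuousOn.comp continuous_fst.continuousOn hfst).rpow_const fun p hp =>
      Or.inl (Vn_pos n l (hsph _ hp.1)).ne'
  have hcF : ContinuousOn (fun p : (Fin n → ℝ) × ℝ =>
      fderiv ℝ (Vn n l) p.1 (Jmat n *ᵥ p.1 + p.2 • eVec n n)) S := by
    refine ContinuousOn.clm_apply
      ((hV.continuousOn_fderiv_of_isOpen hopen le_rfl).comp continuous_fst.continuousOn hfst) ?_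
    exact Continuous.continuousOn (by fun_prop)
  obtain ⟨K, hK⟩ := ((isCompact_sphere (0 : Fin n → ℝ) 1).prod isCompact_Icc
    |>.exists_bound_of_continuousOn (hcF.mul hcV))
  refine ⟨max K 1, by positivity, fun x hx u hu => ?_⟩
  have hx0 : x ≠ 0 := by
    rintro rfl
    have h2 := Vn_dil n l (two_pos : (0 : ℝ) < 2) 0
    rw [map_zero] at h2
    have h3 : (1 : ℝ) < 2 ^ ((2 * n - 1) / n : ℝ) :=
      Real.one_lt_rpow one_lt_two (div_pos (by linarith) (by linarith))
    nlinarith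
  obtain ⟨t, ht, y, hy, rfl⟩ := exists_eq_dil hx0
  have hyS : y ∈ Metric.sphere (0 : Fin n → ℝ) 1 := by simpa using hy
  have hy0 := hsph y hyS
  have hVy := Vn_pos n l hy0
  have hb := hK (y, u) ⟨hyS, abs_le.1 hu⟩
  have hVa : 0 < Vn n l y ^ al n := Real.rpow_pos_of_pos hVy _
  rw [Pi.mul_apply, norm_mul, Real.norm_eq_abs, Real.norm_eq_abs, Real.rpow_neg hVy.le, abs_inv,
    abs_of_pos hVa, ← div_eq_mul_inv, div_le_iff₀ hVa] at hb
  have hexp : (2 * n - 1) / n * al n = -(n : ℝ)⁻¹ + (2 * n - 1) / n := by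
    have h1 : (2 * n - 1 : ℝ) ≠ 0 := by linarith
    rw [al]
    field_simp
    ring
  have ha : 0 < t ^ ((2 * n - 1) / n : ℝ) := Real.rpow_pos_of_pos ht _
  have hab : 0 < t ^ (-(n : ℝ)⁻¹ + (2 * n - 1) / n) := Real.rpow_pos_of_pos ht _
  rw [Jmat_mulVec_dil hn ht, map_smul, fderiv_Vn_dil ht (hdiff _ hx0) (hdiff _ hy0), Vn_dil n l ht,
    Real.mul_rpow ha.le hVy.le, ← Real.rpow_mul ht.le, hexp, smul_eq_mul, ← mul_assoc,
    ← Real.rpow_add ht, abs_mul, abs_of_pos hab, mul_left_comm]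
  refine mul_le_mul_of_nonneg_left (hb.trans ?_) hab.le
  exact mul_le_mul_of_nonneg_right (le_max_left _ _) hVa.le
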